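/- Let 𝓕 be a Kalton space on U with values in Σ, let s ∈ U, let n ∈ ℕ ∪ {0}, and let φ_s : U → 𝔻 be a conformal equivalence with φ_s(s) = 0. Then the map f ↦ φ_s^{n+1}·f is a surjective linear isometry from 𝓕 onto the subspace ⋂_{0 ≤ k ≤ n} ker δ_s^{(k)} = { g ∈ 𝓕 : g(s) = g'(s) = ... = g^{(n)}(s) = 0 }. In particular (case n = 0) ker δ_s is isometric to 𝓕, and consequently ker δ_s and ker δ_t are isometric for all s, t ∈ U. -/

import Mathlib

open Complex Metric Set

noncomputable section

/-- A conformal equivalence (analytic bijection) of `U` onto `V`. -/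
def ConformalEquivOn (φ : ℂ → ℂ) (U V : Set ℂ) : Prop :=
  DifferentiableOn ℂ φ U ∧ Set.BijOn φ U V

/-- A Kalton space of analytic functions on an open set `U ⊆ ℂ` conformally equivalent to the
open unit disc, with values in the complex Banach space `Sig`.  The Banach carrier is `F`, whose
elements are identified with analytic functions `ℂ → Sig` (only the restriction to `U` matters)
via the injective linear map `toFun`. -/
structure KaltonSpace (U : Set ℂ) (Sig : Type*) (F : Type*)
    [NormedAddCommGroup Sig] [NormedSpace ℂ Sig] [CompleteSpace Sig]
    [NormedAddCommGroup F] [NormedSpace ℂ F] [CompleteSpace F] where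
  isOpen : IsOpen U
  conformal_exists : ∃ φ : ℂ → ℂ, ConformalEquivOn φ U (Metric.ball (0 : ℂ) 1)
  toFun : F →ₗ[ℂ] (ℂ → Sig)
  inj : ∀ f g : F, Set.EqOn (toFun f) (toFun g) U → f = g
  analytic : ∀ f : F, DifferentiableOn ℂ (toFun f) U
  eval_bound : ∀ z ∈ U, ∃ C : ℝ, ∀ f : F, ‖toFun f z‖ ≤ C * ‖f‖
  conf_mul_mem : ∀ φ : ℂ → ℂ, ConformalEquivOn φ U (Metric.ball (0 : ℂ) 1) →
    ∀ f : F, ∃ g : F, (∀ z ∈ U, toFun g z = φ z • toFun f z) ∧ ‖g‖ = ‖f‖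
  conf_div_mem : ∀ φ : ℂ → ℂ, ConformalEquivOn φ U (Metric.ball (0 : ℂ) 1) →
    ∀ h : ℂ → Sig, DifferentiableOn ℂ h U →
    ∀ g : F, (∀ z ∈ U, toFun g z = φ z • h z) →
    ∃ f : F, (∀ z ∈ U, toFun f z = h z) ∧ ‖f‖ = ‖g‖

namespace KaltonSpace

variable {U : Set ℂ} {Sig F : Type*}
  [NormedAddCommGroup Sig] [NormedSpace ℂ Sig] [CompleteSpace Sig]
  [NormedAddCommGroup F] [NormedSpace ℂ F] [CompleteSpace F]

/-- `x` belongs to the interpolation space `X_z = {f z : f ∈ 𝓕}`. -/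
def MemX (K : KaltonSpace U Sig F) (z : ℂ) (x : Sig) : Prop :=
  ∃ f : F, K.toFun f z = x

/-- The quotient norm `‖x‖_z = inf {‖f‖ : f ∈ 𝓕, f z = x}` of `X_z`. -/
def normX (K : KaltonSpace U Sig F) (z : ℂ) (x : Sig) : ℝ :=
  sInf {r : ℝ | ∃ f : F, K.toFun f z = x ∧ r = ‖f‖}

/-- `B` is a homogeneous bounded selection for the evaluation `δ_z`, with constant `c`. -/
def IsSelection (K : KaltonSpace U Sig F) (z : ℂ) (c : ℝ) (B : Sig → F) : Prop :=
  (∀ (l : ℂ) (x : Sig), K.MemX z x → B (l • x) = l • B x) ∧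
  (∀ x : Sig, K.MemX z x → K.toFun (B x) z = x) ∧
  (∀ x : Sig, K.MemX z x → ‖B x‖ ≤ c * K.normX z x)

end KaltonSpace

open Filter Topology in
/-- An injective holomorphic function on an open set has nowhere vanishing derivative. -/
theorem deriv_ne_zero_of_injOn {φ : ℂ → ℂ} {U : Set ℂ} (hU : IsOpen U)
    (hd : DifferentiableOn ℂ φ U) (hi : Set.InjOn φ U) {s : ℂ} (hs : s ∈ U) :
    deriv φ s ≠ 0 := by
  have not_const : ∀ z ∈ U, ¬ ∀ᶠ w in 𝓝 z, φ w = φ z := by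
    intro z hz h
    have : ∀ᶠ w in 𝓝[≠] z, w = z := by
      filter_upwards [nhdsWithin_le_nhds h, nhdsWithin_le_nhds (hU.mem_nhds hz)] with w hw hwU
      exact hi hwU hz hw
    obtain ⟨w, hw, hw'⟩ := (this.and self_mem_nhdsWithin).exists
    exact hw' hw
  have an : ∀ z ∈ U, AnalyticAt ℂ φ z := fun z hz => hd.analyticAt (hU.mem_nhds hz)
  have nhds_le : ∀ z ∈ U, 𝓝 (φ z) ≤ map φ (𝓝 z) := fun z hz =>
    (an z hz).eventually_constant_or_nhds_le_map_nhds.resolve_left (not_const z hz)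
  set ψ := Function.invFunOn φ U
  have left : ∀ z ∈ U, ψ (φ z) = z := fun z hz => hi.leftInvOn_invFunOn hz
  have cont : ∀ z ∈ U, ContinuousAt ψ (φ z) := by
    intro z hz
    rw [ContinuousAt, left z hz]
    refine (tendsto_map'_iff.2 ?_ : Tendsto ψ (map φ (𝓝 z)) (𝓝 z)).mono_left (nhds_le z hz)
    refine tendsto_id.congr' ?_
    filter_upwards [hU.mem_nhds hz] with w hw using (left w hw).symm
  have deriv_ne : ∀ᶠ z in 𝓝[≠] s, deriv φ z ≠ 0 := by
    refine (an s hs).deriv.eventually_eq_zero_or_eventually_ne_zero.resolve_left fun h => ?_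
    obtain ⟨r, hr, hball⟩ := Metric.eventually_nhds_iff_ball.1 (h.and (hU.mem_nhds hs))
    refine not_const s hs ?_
    filter_upwards [Metric.ball_mem_nhds s hr] with w hw
    exact Metric.isOpen_ball.is_const_of_deriv_eq_zero
      (convex_ball s r).isPreconnected (hd.mono fun x hx => (hball x hx).2)
      (fun x hx => (hball x hx).1) hw (Metric.mem_ball_self hr)
  have diff : ∀ᶠ w in 𝓝[≠] (φ s), DifferentiableAt ℂ ψ w := by
    rw [eventually_nhdsWithin_iff]
    refine nhds_le s hs ?_
    rw [mem_map]
    filter_upwards [eventually_nhdsWithin_iff.1 deriv_ne, hU.mem_nhds hs] with z hz hzU hne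
    have hz' : deriv φ z ≠ 0 := hz fun h => hne (by rw [h]; rfl)
    refine (HasDerivAt.of_local_left_inverse (f := φ) (cont z hzU) (f' := deriv φ z)
      ?_ hz' ?_).differentiableAt
    · rw [left z hzU]; exact (an z hzU).differentiableAt.hasDerivAt
    · refine nhds_le z hzU ?_
      rw [mem_map]
      filter_upwards [hU.mem_nhds hzU] with w hw
      simp only [Set.mem_preimage, Set.mem_ofPred_eq, left w hw]
  have hψ := (Complex.analyticAt_of_differentiable_on_punctured_nhds_of_continuousAt diff
    (cont s hs)).differentiableAt.hasDerivAt
  have comp := hψ.comp s (an s hs).differentiableAt.hasDerivAt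
  have hid : HasDerivAt (ψ ∘ φ) 1 s := by
    refine (hasDerivAt_id s).congr_of_eventuallyEq ?_
    filter_upwards [hU.mem_nhds hs] with w hw using left w hw
  intro h0
  simpa [h0] using comp.unique hid

section Moebius

open ComplexConjugate

/-- The disc automorphism `w ↦ (w - a) / (1 - ā w)`. -/
def discMoebius (a w : ℂ) : ℂ := (w - a) / (1 - conj a * w)

theorem one_sub_conj_mul_ne_zero {a w : ℂ} (ha : ‖a‖ < 1) (hw : ‖w‖ < 1) :
    1 - conj a * w ≠ 0 := by
  intro h
  have h1 : ‖conj a * w‖ = 1 := by rw [← sub_eq_zero.1 h, norm_one]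
  rw [norm_mul, RCLike.norm_conj] at h1
  nlinarith [norm_nonneg a, norm_nonneg w]

theorem norm_discMoebius_lt_one {a w : ℂ} (ha : ‖a‖ < 1) (hw : ‖w‖ < 1) :
    ‖discMoebius a w‖ < 1 := by
  rw [discMoebius, norm_div, div_lt_one (norm_pos_iff.2 (one_sub_conj_mul_ne_zero ha hw))]
  refine lt_of_pow_lt_pow_left₀ 2 (norm_nonneg _) ?_
  have ha' : ‖a‖ ^ 2 < 1 := by nlinarith [norm_nonneg a]
  have hw' : ‖w‖ ^ 2 < 1 := by nlinarith [norm_nonneg w]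
  simp only [Complex.sq_norm, Complex.normSq_apply] at ha' hw' ⊢
  simp only [Complex.sub_re, Complex.sub_im, Complex.mul_re, Complex.mul_im, Complex.conj_re,
    Complex.conj_im, Complex.one_re, Complex.one_im]
  nlinarith [mul_pos (sub_pos.2 ha') (sub_pos.2 hw')]

theorem discMoebius_neg_discMoebius {a w : ℂ} (ha : ‖a‖ < 1) (hw : ‖w‖ < 1) :
    discMoebius (-a) (discMoebius a w) = w := by
  have h := one_sub_conj_mul_ne_zero ha hw
  have h2 := one_sub_conj_mul_ne_zero (a := -a) (by simpa using ha) (norm_discMoebius_lt_one ha hw)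
  have hmul : discMoebius a w * (1 - conj a * w) = w - a := div_mul_cancel₀ _ h
  rw [discMoebius, div_eq_iff h2, map_neg]
  linear_combination hmul

theorem conformalEquivOn_discMoebius {a : ℂ} (ha : ‖a‖ < 1) :
    ConformalEquivOn (discMoebius a) (Metric.ball 0 1) (Metric.ball 0 1) := by
  have ha' : ‖-a‖ < 1 := by simpa using ha
  refine ⟨?_, Set.InvOn.bijOn (f' := discMoebius (-a)) ⟨?_, ?_⟩ ?_ ?_⟩
  · intro w hw
    have := one_sub_conj_mul_ne_zero ha (mem_ball_zero_iff.1 hw)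
    unfold discMoebius
    fun_prop (disch := assumption)
  · exact fun w hw => discMoebius_neg_discMoebius ha (mem_ball_zero_iff.1 hw)
  · intro w hw
    simpa using discMoebius_neg_discMoebius ha' (mem_ball_zero_iff.1 hw)
  · exact fun w hw => mem_ball_zero_iff.2 (norm_discMoebius_lt_one ha (mem_ball_zero_iff.1 hw))
  · exact fun w hw => mem_ball_zero_iff.2 (norm_discMoebius_lt_one ha' (mem_ball_zero_iff.1 hw))

end Moebius

theorem ConformalEquivOn.comp {φ ψ : ℂ → ℂ} {U V W : Set ℂ} (hψ : ConformalEquivOn ψ V W)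
    (hφ : ConformalEquivOn φ U V) : ConformalEquivOn (ψ ∘ φ) U W :=
  ⟨hψ.1.comp hφ.1 hφ.2.mapsTo, hψ.2.comp hφ.2⟩

/-- A conformal equivalence onto the disc can be normalized to vanish at a prescribed point. -/
theorem ConformalEquivOn.exists_apply_eq_zero {φ : ℂ → ℂ} {U : Set ℂ}
    (hφ : ConformalEquivOn φ U (Metric.ball 0 1)) {t : ℂ} (ht : t ∈ U) :
    ∃ ψ : ℂ → ℂ, ConformalEquivOn ψ U (Metric.ball 0 1) ∧ ψ t = 0 :=
  ⟨discMoebius (φ t) ∘ φ,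
    (conformalEquivOn_discMoebius (mem_ball_zero_iff.1 (hφ.2.mapsTo ht))).comp hφ,
    by simp [discMoebius]⟩

namespace KaltonSpace

variable {U : Set ℂ} {Sig F : Type*}
  [NormedAddCommGroup Sig] [NormedSpace ℂ Sig] [CompleteSpace Sig]
  [NormedAddCommGroup F] [NormedSpace ℂ F] [CompleteSpace F]

/-- Multiplication by a conformal equivalence onto the disc is a linear isometry. -/
theorem exists_linearIsometry_mul (K : KaltonSpace U Sig F) {φ : ℂ → ℂ}
    (hφ : ConformalEquivOn φ U (Metric.ball 0 1)) :
    ∃ M : F →ₗᵢ[ℂ] F, ∀ f, ∀ z ∈ U, K.toFun (M f) z = φ z • K.toFun f z := by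
  choose M hM hnorm using K.conf_mul_mem φ hφ
  refine ⟨⟨⟨⟨M, fun f g => ?_⟩, fun c f => ?_⟩, hnorm⟩, hM⟩
  · refine K.inj _ _ fun z hz => ?_
    simp [hM _ z hz]
  · refine K.inj _ _ fun z hz => ?_
    simp [hM _ z hz, smul_comm (φ z) c]

theorem analyticAt (K : KaltonSpace U Sig F) (f : F) {s : ℂ} (hs : s ∈ U) :
    AnalyticAt ℂ (K.toFun f) s :=
  (K.analytic f).analyticAt (K.isOpen.mem_nhds hs)

/-- An element vanishing at the zero of a conformal equivalence `φ` is divisible by `φ`. -/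
theorem exists_eq_smul_of_apply_eq_zero (K : KaltonSpace U Sig F) {φ : ℂ → ℂ}
    (hφ : ConformalEquivOn φ U (Metric.ball 0 1)) {s : ℂ} (hs : s ∈ U) (hφs : φ s = 0)
    {g : F} (hg : K.toFun g s = 0) :
    ∃ f : F, ∀ z ∈ U, K.toFun g z = φ z • K.toFun f z := by
  have hmem := K.isOpen.mem_nhds hs
  have hne : ∀ z ∈ U, dslope φ s z ≠ 0 := by
    intro z hz
    rcases eq_or_ne z s with rfl | hzs
    · rw [dslope_same]
      exact deriv_ne_zero_of_injOn K.isOpen hφ.1 hφ.2.injOn hs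
    · rw [dslope_of_ne _ hzs, slope_def_field, div_ne_zero_iff, sub_ne_zero, sub_ne_zero]
      exact ⟨fun h => hzs (hφ.2.injOn hz hs h), hzs⟩
  have hmul : ∀ z ∈ U, K.toFun g z =
      φ z • (dslope φ s z)⁻¹ • dslope (K.toFun g) s z := by
    intro z hz
    have h1 : (z - s) • dslope φ s z = φ z := by rw [sub_smul_dslope, hφs, sub_zero]
    have h2 : (z - s) • dslope (K.toFun g) s z = K.toFun g z := by
      rw [sub_smul_dslope, hg, sub_zero]
    rw [← h1, smul_smul, smul_eq_mul, mul_assoc, mul_inv_cancel₀ (hne z hz), mul_one, h2]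
  obtain ⟨f, hf, -⟩ := K.conf_div_mem φ hφ
    (fun z => (dslope φ s z)⁻¹ • dslope (K.toFun g) s z)
    ((((Complex.differentiableOn_dslope hmem).2 hφ.1).inv hne).smul
      ((Complex.differentiableOn_dslope hmem).2 (K.analytic g))) g hmul
  exact ⟨f, fun z hz => by rw [hf z hz, hmul z hz]⟩

theorem analyticOrderAt_of_eq_smul (K : KaltonSpace U Sig F) {φ : ℂ → ℂ}
    (hφ : ConformalEquivOn φ U (Metric.ball 0 1)) {s : ℂ} (hs : s ∈ U) (hφs : φ s = 0)
    {f g : F} (h : ∀ z ∈ U, K.toFun g z = φ z • K.toFun f z) :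
    analyticOrderAt (K.toFun g) s = analyticOrderAt (K.toFun f) s + 1 := by
  have hmem := K.isOpen.mem_nhds hs
  have hφa : AnalyticAt ℂ φ s := hφ.1.analyticAt hmem
  have heq : K.toFun g =ᶠ[nhds s] φ • K.toFun f := by
    filter_upwards [hmem] with z hz using h z hz
  rw [analyticOrderAt_congr heq, analyticOrderAt_smul hφa (K.analyticAt f hs),
    hφa.analyticOrderAt_eq_one_of_zero_deriv_ne_zero hφs
      (deriv_ne_zero_of_injOn K.isOpen hφ.1 hφ.2.injOn hs), add_comm]

theorem mem_range_pow_iff (K : KaltonSpace U Sig F) {φ : ℂ → ℂ}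
    (hφ : ConformalEquivOn φ U (Metric.ball 0 1)) {s : ℂ} (hs : s ∈ U) (hφs : φ s = 0)
    {M : F →ₗᵢ[ℂ] F} (hM : ∀ f, ∀ z ∈ U, K.toFun (M f) z = φ z • K.toFun f z)
    (n : ℕ) (g : F) :
    g ∈ Set.range (M ^ n) ↔ (n : ℕ∞) ≤ analyticOrderAt (K.toFun g) s := by
  induction n generalizing g with
  | zero => simp
  | succ n ih =>
    rw [pow_succ', LinearIsometry.coe_mul, Nat.cast_succ]
    constructor
    · rintro ⟨f, rfl⟩
      rw [Function.comp_apply, K.analyticOrderAt_of_eq_smul hφ hs hφs (hM _)]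
      gcongr
      exact (ih _).1 ⟨f, rfl⟩
    · intro h
      have hg : K.toFun g s = 0 := by
        by_contra hne
        rw [(K.analyticAt g hs).analyticOrderAt_eq_zero.2 hne] at h
        simp at h
      obtain ⟨f, hf⟩ := K.exists_eq_smul_of_apply_eq_zero hφ hs hφs hg
      rw [K.analyticOrderAt_of_eq_smul hφ hs hφs hf] at h
      obtain ⟨u, rfl⟩ := (ih f).2 ((ENat.add_le_add_iff_right ENat.one_ne_top).1 h)
      exact ⟨u, K.inj _ _ fun z hz => by rw [Function.comp_apply, hM _ z hz, hf z hz]⟩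

theorem exists_linearIsometry_pow_mul (K : KaltonSpace U Sig F) {φ : ℂ → ℂ}
    (hφ : ConformalEquivOn φ U (Metric.ball 0 1)) {s : ℂ} (hs : s ∈ U) (hφs : φ s = 0) (n : ℕ) :
    ∃ T : F →ₗᵢ[ℂ] F,
      (∀ f, ∀ z ∈ U, K.toFun (T f) z = φ z ^ (n + 1) • K.toFun f z) ∧
      Set.range T = {g : F | ∀ k ≤ n, iteratedDeriv k (K.toFun g) s = 0} := by
  obtain ⟨M, hM⟩ := K.exists_linearIsometry_mul hφ
  refine ⟨M ^ (n + 1), fun f z hz => ?_, ?_⟩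
  · induction n + 1 with
    | zero => simp
    | succ m ih => rw [pow_succ', LinearIsometry.coe_mul, Function.comp_apply, hM _ z hz, ih,
        smul_smul, pow_succ']
  · ext g
    rw [K.mem_range_pow_iff hφ hs hφs hM,
      natCast_le_analyticOrderAt_iff_iteratedDeriv_eq_zero (K.analyticAt g hs)]
    simp only [Nat.lt_succ_iff, Set.mem_ofPred_eq]

theorem exists_linearIsometry_range_eq_ker (K : KaltonSpace U Sig F) {s : ℂ} (hs : s ∈ U) :
    ∃ T : F →ₗᵢ[ℂ] F, Set.range T = {g : F | K.toFun g s = 0} := by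
  obtain ⟨φ, hφ⟩ := K.conformal_exists
  obtain ⟨ψ, hψ, hψs⟩ := hφ.exists_apply_eq_zero hs
  obtain ⟨T, -, hT⟩ := K.exists_linearIsometry_pow_mul hψ hs hψs 0
  exact ⟨T, by simpa using hT⟩

end KaltonSpace

/-- Multiplication by `φ_s^{n+1}` is a surjective linear isometry from `𝓕` onto the subspace
`⋂_{0 ≤ k ≤ n} ker δ_s^{(k)} = {g ∈ 𝓕 : g(s) = g'(s) = ⋯ = g^{(n)}(s) = 0}`.  In particular
(case `n = 0`) `ker δ_s` is isometric to `𝓕`, and consequently `ker δ_s` and `ker δ_t` are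
isometric for all `s, t ∈ U`. -/
theorem statement4 (U : Set ℂ) (Sig F : Type*)
    [NormedAddCommGroup Sig] [NormedSpace ℂ Sig] [CompleteSpace Sig]
    [NormedAddCommGroup F] [NormedSpace ℂ F] [CompleteSpace F]
    (K : KaltonSpace U Sig F) (s : ℂ) (hs : s ∈ U) (n : ℕ)
    (φs : ℂ → ℂ) (hφ : ConformalEquivOn φs U (Metric.ball (0 : ℂ) 1)) (hφs : φs s = 0) :
    (∃ T : F →ₗ[ℂ] F,
      (∀ f : F, ∀ z ∈ U, K.toFun (T f) z = (φs z) ^ (n + 1) • K.toFun f z) ∧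
      (∀ f : F, ‖T f‖ = ‖f‖) ∧
      Set.range T = {g : F | ∀ k ≤ n, iteratedDeriv k (K.toFun g) s = 0}) ∧
    (∀ t ∈ U, ∃ Φ : F → F,
      Set.BijOn Φ {f : F | K.toFun f s = 0} {f : F | K.toFun f t = 0} ∧
      (∀ f g : F, K.toFun f s = 0 → K.toFun g s = 0 → Φ (f + g) = Φ f + Φ g) ∧
      (∀ (c : ℂ) (f : F), K.toFun f s = 0 → Φ (c • f) = c • Φ f) ∧
      (∀ f : F, K.toFun f s = 0 → ‖Φ f‖ = ‖f‖)) := by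
  refine ⟨?_, fun t ht => ?_⟩
  · obtain ⟨T, hT, hrange⟩ := K.exists_linearIsometry_pow_mul hφ hs hφs n
    exact ⟨T.toLinearMap, hT, T.norm_map, hrange⟩
  · obtain ⟨S, hS⟩ := K.exists_linearIsometry_range_eq_ker hs
    obtain ⟨T, hT⟩ := K.exists_linearIsometry_range_eq_ker ht
    have hSmem : ∀ f, K.toFun f s = 0 → ∃ u, S u = f := fun f hf => hS.symm.subset hf
    have hinv : ∀ u, Function.invFun S (S u) = u := Function.leftInverse_invFun S.injective
    refine ⟨fun f => T (Function.invFun S f), ⟨?_, ?_, ?_⟩, ?_, ?_, ?_⟩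
    · exact fun f _ => hT.subset ⟨_, rfl⟩
    · intro f hf g hg hfg
      obtain ⟨u, rfl⟩ := hSmem f hf
      obtain ⟨v, rfl⟩ := hSmem g hg
      simp only [hinv] at hfg
      rw [T.injective hfg]
    · intro g hg
      obtain ⟨u, rfl⟩ := hT.symm.subset hg
      exact ⟨S u, hS.subset ⟨u, rfl⟩, by simp only [hinv]⟩
    · intro f g hf hg
      obtain ⟨u, rfl⟩ := hSmem f hf
      obtain ⟨v, rfl⟩ := hSmem g hg
      simp only [← map_add, hinv]
    · intro c f hf
      obtain ⟨u, rfl⟩ := hSmem f hf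
      simp only [← map_smul, hinv]
    · intro f hf
      obtain ⟨u, rfl⟩ := hSmem f hf
      simp only [hinv, LinearIsometry.norm_map]
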